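/- Almost-sure existence of a gentle disintegration. Let Γ, γ be moderately steep scales with parameters a > 0 and ε ∈ (0,1), let Q be a probability measure on Ω = {0,1}^{ℤ^d} satisfying the decay condition (smin) with constants b'', B'', assume p = sup_x Q(ω_x = 1) ≤ exp{−a/(1−ε)}, and assume condition (gag): 2·9^d·B''·θ_{k+1}^{2d}·exp{−b''Γ_{k+1}/20} ≤ exp{−a(1+ε)^{k+1}/(1−ε)} for all k ≥ 0. Set G_0(ω) = {x ∈ ℤ^d : ω_x = 0}. Then there exists a measurable set Ω̄ ⊆ Ω with Q(Ω̄) = 1 such that for every ω ∈ Ω̄ there exists a gentle disintegration 𝒢(ω) of ℤ^d with respect to G_0(ω), Γ, γ. -/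

import Mathlib

namespace Paper

open MeasureTheory

noncomputable section

/-- The lattice `ℤ^d`. -/
abbrev ZLat (d : ℕ) := Fin d → ℤ

/-- A disorder configuration `ω ∈ {0,1}^{ℤ^d}` (`true` = bad site). -/
abbrev DConf (d : ℕ) := ZLat d → Bool

/-- The `ℓ¹` distance on `ℤ^d`. -/
def D1 {d : ℕ} (x y : ZLat d) : ℕ := ∑ i, (x i - y i).natAbs

/-- The sup distance on `ℤ^d`. -/
def supD {d : ℕ} (x y : ZLat d) : ℕ := Finset.univ.sup fun i => (x i - y i).natAbs

/-- The `ℓ¹` ball `O_r(x)` of (real) radius `r` around `x`. -/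
def ball1 {d : ℕ} (x : ZLat d) (r : ℝ) : Set (ZLat d) := {y | (D1 x y : ℝ) ≤ r}

/-- The `ℓ¹` neighborhood `O_r(X)` of a set `X`. -/
def nbd1 {d : ℕ} (X : Set (ZLat d)) (r : ℝ) : Set (ZLat d) :=
  {y | ∃ x ∈ X, (D1 x y : ℝ) ≤ r}

/-- The σ-algebra `𝒜_Λ` generated by the coordinates in `Λ`. -/
def cylSigma {d : ℕ} (Λ : Set (ZLat d)) : MeasurableSpace (DConf d) :=
  MeasurableSpace.comap (fun ω => fun x : Λ => ω x) inferInstance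

/-- `f` is a local function with support contained in the finite set `S`. -/
def LocalOn {d : ℕ} (f : DConf d → ℝ) (S : Finset (ZLat d)) : Prop :=
  ∀ σ τ : DConf d, (∀ x ∈ S, σ x = τ x) → f σ = f τ

/-- Sup norm of a real valued function. -/
def supNorm {α : Type*} (f : α → ℝ) : ℝ := ⨆ a, |f a|

/-- The `ℓ¹` distance between two finite subsets of the lattice. -/
def fDist1 {d : ℕ} (A B : Finset (ZLat d)) : ℝ :=
  sInf ((fun p : ZLat d × ZLat d => (D1 p.1 p.2 : ℝ)) '' {p | p.1 ∈ A ∧ p.2 ∈ B})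

/-- The decay condition (smin): exponential decay of correlations of `Q`. -/
def Smin {d : ℕ} (Q : Measure (DConf d)) (b'' B'' : ℝ) : Prop :=
  ∀ (f g : DConf d → ℝ) (Sf Sg : Finset (ZLat d)),
    LocalOn f Sf → LocalOn g Sg →
    (min Sf.card Sg.card : ℝ) * Real.exp (-b'' * fDist1 Sf Sg) ≤ 1 →
    |(∫ ω, f ω * g ω ∂Q) - (∫ ω, f ω ∂Q) * ∫ ω, g ω ∂Q| ≤
      B'' * supNorm f * supNorm g * (min Sf.card Sg.card : ℝ) *
        Real.exp (-b'' * fDist1 Sf Sg)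

/-- `θ_j = ∑_{i=0}^{j} (Γ_i + γ_i)`. -/
def theta (Γ γ : ℕ → ℝ) (j : ℕ) : ℝ := ∑ i ∈ Finset.range (j + 1), (Γ i + γ i)

/-- Moderately steep scales, with parameters `a > 0` and `ε ∈ (0,1)`
(items (1)–(5) of the definition). -/
structure ModSteep (d : ℕ) (Γ γ : ℕ → ℝ) (a ε : ℝ) : Prop where
  gammaBigMono : StrictMono Γ
  gammaSmallMono : StrictMono γ
  gammaBigZero : Γ 0 = 0
  gammaSmallZero : 0 ≤ γ 0
  gammaBigOne : 2 ≤ Γ 1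
  halfLt : ∀ j : ℕ, 1 ≤ j → Γ j < γ j / 2
  lam : ∀ j : ℕ, 10 * theta Γ γ j ≤ Γ (j + 1)
  covolSummable : Summable (fun j : ℕ => if j = 0 then (0 : ℝ) else Γ j / γ j)
  covol : (∑' j : ℕ, if j = 0 then (0 : ℝ) else Γ j / γ j) ≤ 1 / 2
  apos : 0 < a
  epsMem : ε ∈ Set.Ioo (0 : ℝ) 1
  growth : ∀ k : ℕ, 2 * 3 ^ d * theta Γ γ (k + 1) ^ d ≤ Real.exp (a * (1 + ε) ^ k)
  tail : ∀ s : ℝ, 0 ≤ s → ∀ q : ℝ, 1 < q →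
    Summable fun k : ℕ => theta Γ γ k ^ s * Real.exp (-a * (1 + ε) ^ k / q)

/-- `x` is a gentle point at level `k ≥ 1` with respect to the set `Bprev` of
`(k-1)`-bad points: `x ∈ Bprev`, the atom `A = O_{Γ_k}(x) ∩ Bprev` has `ℓ¹` diameter
at most `Γ_k`, and `D(A, Bprev ∖ A) > γ_k`. -/
def gentleOn {d : ℕ} (Γ γ : ℕ → ℝ) (Bprev : Set (ZLat d)) (k : ℕ) (x : ZLat d) : Prop :=
  x ∈ Bprev ∧
  (∀ u ∈ ball1 x (Γ k) ∩ Bprev, ∀ v ∈ ball1 x (Γ k) ∩ Bprev, (D1 u v : ℝ) ≤ Γ k) ∧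
  (∀ u ∈ ball1 x (Γ k) ∩ Bprev, ∀ v ∈ Bprev \ (ball1 x (Γ k) ∩ Bprev),
    γ k < (D1 u v : ℝ))

/-- The recursive classification of badness: `B_0(ω) = {x : ω_x = 1}` and
`B_k(ω) = B_{k-1}(ω)` minus the `k`-gentle points. -/
def badSet {d : ℕ} (Γ γ : ℕ → ℝ) (ω : DConf d) : ℕ → Set (ZLat d)
  | 0 => {x | ω x = true}
  | k + 1 => {x | x ∈ badSet Γ γ ω k ∧ ¬ gentleOn Γ γ (badSet Γ γ ω k) (k + 1) x}

/-- The `k`-gentle sites: `G_0(ω) = {x : ω_x = 0}`, `G_k(ω) = B_{k-1}(ω) ∖ B_k(ω)`. -/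
def gentleSet {d : ℕ} (Γ γ : ℕ → ℝ) (ω : DConf d) : ℕ → Set (ZLat d)
  | 0 => {x | ω x = false}
  | k + 1 => badSet Γ γ ω k \ badSet Γ γ ω (k + 1)

/-- The collection of `k`-gentle atoms `𝒢_k(ω)` (for `k ≥ 1`):
`A = O_{Γ_k}(x) ∩ B_{k-1}(ω)` for `x` a `k`-gentle point. -/
def atomsAt {d : ℕ} (Γ γ : ℕ → ℝ) (ω : DConf d) (k : ℕ) : Set (Set (ZLat d)) :=
  {A | ∃ x : ZLat d, gentleOn Γ γ (badSet Γ γ ω (k - 1)) k x ∧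
        A = ball1 x (Γ k) ∩ badSet Γ γ ω (k - 1)}

/-- The smallest coordinate parallelepiped `Env(g)` containing `g`. -/
def env {d : ℕ} (g : Set (ZLat d)) : Set (ZLat d) :=
  {x | ∀ i : Fin d, (∃ u ∈ g, u i ≤ x i) ∧ ∃ v ∈ g, x i ≤ v i}

/-- The residual bad sets of a graded family of atoms:
`B_0 = 𝕃 ∖ G_0`, `B_j = B_{j-1} ∖ ⋃(atoms of grade j)`. -/
def Bres {d : ℕ} (G0 : Set (ZLat d)) (atoms : ℕ → Set (Set (ZLat d))) : ℕ → Set (ZLat d)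
  | 0 => G0ᶜ
  | k + 1 => Bres G0 atoms k \ ⋃ g ∈ atoms (k + 1), g

/-- A gentle disintegration of `ℤ^d` with respect to `G0` and the scales `Γ, γ`. -/
structure GentleDisintegration (d : ℕ) (G0 : Set (ZLat d)) (Γ γ : ℕ → ℝ) where
  atoms : ℕ → Set (Set (ZLat d))
  atomFinite : ∀ j, ∀ g ∈ atoms j, g.Finite
  atomNonempty : ∀ j, ∀ g ∈ atoms j, g.Nonempty
  uniqueGrade : ∀ j j' g, g ∈ atoms j → g ∈ atoms j' → j = j'
  pairwiseDisjoint : ∀ j j' g g', g ∈ atoms j → g' ∈ atoms j' → g ≠ g' → Disjoint g g'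
  cover : ∀ x : ZLat d, ∃ j, ∃ g ∈ atoms j, x ∈ g
  grade0 : atoms 0 = {s | ∃ x ∈ G0, s = {x}}
  subsBad : ∀ j, ∀ g ∈ atoms (j + 1), g ⊆ Bres G0 atoms j
  diamBound : ∀ j, 1 ≤ j → ∀ g ∈ atoms j, ∀ u ∈ g, ∀ v ∈ g, (D1 u v : ℝ) ≤ Γ j
  separation : ∀ j, ∀ g ∈ atoms (j + 1), ∀ u ∈ g, ∀ v ∈ Bres G0 atoms j \ g,
    γ (j + 1) < (D1 u v : ℝ)
  horizon : ∀ x : ZLat d,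
    {j : ℕ | 1 ≤ j ∧ ∃ g ∈ atoms j, ∃ y ∈ env g, (supD x y : ℝ) ≤ theta Γ γ j}.Finite

section Geometry

variable {d : ℕ}

lemma D1_self (x : ZLat d) : D1 x x = 0 := by simp [D1]

lemma D1_comm (x y : ZLat d) : D1 x y = D1 y x := by
  unfold D1
  exact Finset.sum_congr rfl fun i _ => by omega

lemma D1_triangle (x y z : ZLat d) : D1 x z ≤ D1 x y + D1 y z := by
  unfold D1
  rw [← Finset.sum_add_distrib]
  exact Finset.sum_le_sum fun i _ => by omega

lemma D1_triangle_real (x y z : ZLat d) : (D1 x z : ℝ) ≤ D1 x y + D1 y z := by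
  exact_mod_cast D1_triangle x y z

lemma natAbs_le_D1 (x y : ZLat d) (i : Fin d) : (x i - y i).natAbs ≤ D1 x y :=
  Finset.single_le_sum (f := fun i => (x i - y i).natAbs) (fun _ _ => Nat.zero_le _)
    (Finset.mem_univ i)

/-- The cube of sup-radius `n` around `x`. -/
def cube (x : ZLat d) (n : ℕ) : Finset (ZLat d) :=
  Finset.Icc (fun i => x i - n) (fun i => x i + n)

lemma mem_cube {x y : ZLat d} {n : ℕ} : y ∈ cube x n ↔ ∀ i, (x i - y i).natAbs ≤ n := by
  simp only [cube, Finset.mem_Icc, Pi.le_def]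
  constructor
  · rintro ⟨h1, h2⟩ i
    have := h1 i
    have := h2 i
    omega
  · intro h
    exact ⟨fun i => by have := h i; omega, fun i => by have := h i; omega⟩

lemma card_cube (x : ZLat d) (n : ℕ) : (cube x n).card = (2 * n + 1) ^ d := by
  have h : ∀ i, (x i + n + 1 - (x i - n)).toNat = 2 * n + 1 := fun i => by omega
  simp [cube, Pi.card_Icc, h]

/-- The `ℓ¹` ball of real radius `r` around `x`, as a finite set. -/
def ballFinset (x : ZLat d) (r : ℝ) : Finset (ZLat d) :=
  (cube x ⌊r⌋₊).filter fun y => (D1 x y : ℝ) ≤ r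

lemma mem_ballFinset {x y : ZLat d} {r : ℝ} : y ∈ ballFinset x r ↔ (D1 x y : ℝ) ≤ r := by
  simp only [ballFinset, Finset.mem_filter, mem_cube, and_iff_right_iff_imp]
  intro h i
  exact (natAbs_le_D1 x y i).trans (Nat.le_floor h)

lemma finite_ball1 (x : ZLat d) (r : ℝ) : (ball1 x r).Finite :=
  (ballFinset x r).finite_toSet.subset fun _ hy => mem_ballFinset.2 hy

lemma card_ballFinset_le (x : ZLat d) {r R : ℝ} (h0 : 0 ≤ r) (hr : r ≤ R) (hR : 1 ≤ R) :
    ((ballFinset x r).card : ℝ) ≤ 3 ^ d * R ^ d := by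
  calc ((ballFinset x r).card : ℝ) ≤ ((cube x ⌊r⌋₊).card : ℝ) := by
        exact_mod_cast Finset.card_filter_le _ _
    _ = (2 * (⌊r⌋₊ : ℝ) + 1) ^ d := by rw [card_cube]; push_cast; rfl
    _ ≤ (3 * R) ^ d := by
        gcongr
        have := Nat.floor_le h0
        linarith
    _ = 3 ^ d * R ^ d := mul_pow _ _ _

lemma natAbs_le_of_mem_env {g : Set (ZLat d)} {r : ℝ}
    (hg : ∀ u ∈ g, ∀ v ∈ g, (D1 u v : ℝ) ≤ r) {y u : ZLat d} (hy : y ∈ env g) (hu : u ∈ g)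
    (i : Fin d) : ((y i - u i).natAbs : ℝ) ≤ r := by
  obtain ⟨⟨v, hv, hvy⟩, w, hw, hwy⟩ := hy i
  have h1 := natAbs_le_D1 v u i
  have h2 := natAbs_le_D1 w u i
  rcases le_total (u i) (y i) with h | h
  · refine le_trans ?_ (hg w hw u hu)
    have : (y i - u i).natAbs ≤ D1 w u := by omega
    exact_mod_cast this
  · refine le_trans ?_ (hg v hv u hu)
    have : (y i - u i).natAbs ≤ D1 v u := by omega
    exact_mod_cast this

end Geometry

section Gentle

variable {d : ℕ} {Γ γ : ℕ → ℝ} {B B' : Set (ZLat d)} {k : ℕ} {x : ZLat d}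

lemma gentleOn.congr (hγ : 0 ≤ γ k) (hΓ : 0 ≤ Γ k)
    (hB : ∀ y, (D1 x y : ℝ) ≤ Γ k + γ k → (y ∈ B ↔ y ∈ B'))
    (h : gentleOn Γ γ B k x) : gentleOn Γ γ B' k x := by
  obtain ⟨hx, hdiam, hsep⟩ := h
  have hball : ∀ u ∈ ball1 x (Γ k) ∩ B', u ∈ ball1 x (Γ k) ∩ B := by
    rintro u ⟨hu, huB⟩
    have hu' : (D1 x u : ℝ) ≤ Γ k := hu
    exact ⟨hu, (hB u (by linarith)).2 huB⟩
  refine ⟨(hB x (by rw [D1_self]; push_cast; linarith)).1 hx,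
    fun u hu v hv => hdiam u (hball u hu) v (hball v hv), fun u hu v hv => ?_⟩
  by_contra! hle
  have hxu : (D1 x u : ℝ) ≤ Γ k := hu.1
  have hxv := D1_triangle_real x u v
  have hvB : v ∈ B := (hB v (by linarith)).2 hv.1
  have := hsep u (hball u hu) v ⟨hvB, fun h => hv.2 ⟨h.1, hv.1⟩⟩
  linarith

lemma gentleOn_congr (hγ : 0 ≤ γ k) (hΓ : 0 ≤ Γ k)
    (hB : ∀ y, (D1 x y : ℝ) ≤ Γ k + γ k → (y ∈ B ↔ y ∈ B')) :
    gentleOn Γ γ B k x ↔ gentleOn Γ γ B' k x :=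
  ⟨gentleOn.congr hγ hΓ hB, gentleOn.congr hγ hΓ fun y hy => (hB y hy).symm⟩

/-- A bad point that fails to be gentle has another bad point at intermediate distance. -/
lemma exists_far_of_not_gentleOn (hγ : 0 ≤ γ k) (hΓ : 0 ≤ Γ k) (hx : x ∈ B)
    (h : ¬ gentleOn Γ γ B k x) :
    ∃ y ∈ B, Γ k / 2 ≤ (D1 x y : ℝ) ∧ (D1 x y : ℝ) ≤ Γ k + γ k := by
  by_contra! hno
  refine h ⟨hx, fun u hu v hv => ?_, fun u hu v hv => ?_⟩
  · have hxu : (D1 x u : ℝ) ≤ Γ k := hu.1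
    have hxv : (D1 x v : ℝ) ≤ Γ k := hv.1
    have hu2 : (D1 x u : ℝ) < Γ k / 2 := by
      by_contra! hc
      have := hno u hu.2 hc
      linarith
    have hv2 : (D1 x v : ℝ) < Γ k / 2 := by
      by_contra! hc
      have := hno v hv.2 hc
      linarith
    have := D1_triangle_real u x v
    rw [D1_comm u x] at this
    linarith
  · have hxu : (D1 x u : ℝ) ≤ Γ k := hu.1
    have hxv : Γ k < (D1 x v : ℝ) := by
      by_contra! hc
      exact hv.2 ⟨hc, hv.1⟩
    have := hno v hv.1 (by linarith)
    have := D1_triangle_real x u v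
    linarith

/-- Every point of a gentle atom generates the same atom. -/
lemma gentleOn.atom_eq (h : gentleOn Γ γ B k x) (hlt : Γ k < γ k) {u : ZLat d}
    (hu : u ∈ ball1 x (Γ k) ∩ B) : ball1 u (Γ k) ∩ B = ball1 x (Γ k) ∩ B := by
  ext v
  constructor
  · intro hv
    by_contra hc
    have h1 := h.2.2 u hu v ⟨hv.2, hc⟩
    have h2 : (D1 u v : ℝ) ≤ Γ k := hv.1
    linarith
  · intro hv
    exact ⟨h.2.1 u hu v hv, hv.2⟩

lemma gentleOn.of_mem_atom (h : gentleOn Γ γ B k x) (hlt : Γ k < γ k) {u : ZLat d}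
    (hu : u ∈ ball1 x (Γ k) ∩ B) : gentleOn Γ γ B k u := by
  refine ⟨hu.2, ?_⟩
  rw [h.atom_eq hlt hu]
  exact h.2

lemma gentleOn.self_mem (h : gentleOn Γ γ B k x) (hΓ : 0 ≤ Γ k) : x ∈ ball1 x (Γ k) ∩ B := by
  refine ⟨?_, h.1⟩
  change (D1 x x : ℝ) ≤ Γ k
  rw [D1_self]
  exact_mod_cast hΓ

end Gentle

namespace ModSteep

variable {d : ℕ} {Γ γ : ℕ → ℝ} {a ε : ℝ}

lemma gammaBig_nonneg (hs : ModSteep d Γ γ a ε) (j : ℕ) : 0 ≤ Γ j := by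
  rw [← hs.gammaBigZero]
  exact hs.gammaBigMono.monotone (Nat.zero_le j)

lemma gammaSmall_nonneg (hs : ModSteep d Γ γ a ε) (j : ℕ) : 0 ≤ γ j :=
  hs.gammaSmallZero.trans (hs.gammaSmallMono.monotone (Nat.zero_le j))

lemma two_le_gammaBig_succ (hs : ModSteep d Γ γ a ε) (j : ℕ) : 2 ≤ Γ (j + 1) :=
  hs.gammaBigOne.trans (hs.gammaBigMono.monotone (by omega))

lemma gammaBig_lt (hs : ModSteep d Γ γ a ε) (j : ℕ) : Γ (j + 1) < γ (j + 1) := by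
  have := hs.halfLt (j + 1) (by omega)
  have := hs.gammaBig_nonneg (j + 1)
  linarith

lemma theta_succ (Γ γ : ℕ → ℝ) (j : ℕ) :
    theta Γ γ (j + 1) = theta Γ γ j + (Γ (j + 1) + γ (j + 1)) :=
  Finset.sum_range_succ _ _

lemma theta_nonneg (hs : ModSteep d Γ γ a ε) (j : ℕ) : 0 ≤ theta Γ γ j :=
  Finset.sum_nonneg fun i _ => add_nonneg (hs.gammaBig_nonneg i) (hs.gammaSmall_nonneg i)

lemma add_le_theta_succ (hs : ModSteep d Γ γ a ε) (j : ℕ) :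
    Γ (j + 1) + γ (j + 1) ≤ theta Γ γ (j + 1) := by
  have := hs.theta_nonneg j
  rw [theta_succ]
  linarith

lemma theta_le_succ (hs : ModSteep d Γ γ a ε) (j : ℕ) :
    theta Γ γ j ≤ theta Γ γ (j + 1) := by
  have := hs.gammaBig_nonneg (j + 1)
  have := hs.gammaSmall_nonneg (j + 1)
  rw [theta_succ]
  linarith

lemma one_le_theta_succ (hs : ModSteep d Γ γ a ε) (j : ℕ) : 1 ≤ theta Γ γ (j + 1) := by
  have := hs.add_le_theta_succ j
  have := hs.two_le_gammaBig_succ j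
  have := hs.gammaSmall_nonneg (j + 1)
  linarith

end ModSteep

section BadSet

variable {d : ℕ} {Γ γ : ℕ → ℝ} {a ε : ℝ}

lemma badSet_antitone (ω : DConf d) : Antitone (badSet Γ γ ω) :=
  antitone_nat_of_succ_le fun _ _ hx => hx.1

/-- Whether `x` is `k`-bad is determined by the configuration within distance `θ_k` of `x`. -/
lemma mem_badSet_congr (hs : ModSteep d Γ γ a ε) (k : ℕ) :
    ∀ (x : ZLat d) (σ τ : DConf d), (∀ y, (D1 x y : ℝ) ≤ theta Γ γ k → σ y = τ y) →
      (x ∈ badSet Γ γ σ k ↔ x ∈ badSet Γ γ τ k) := by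
  induction k with
  | zero =>
    intro x σ τ h
    have := h x (by rw [D1_self]; exact_mod_cast hs.theta_nonneg 0)
    simp [badSet, this]
  | succ k ih =>
    intro x σ τ h
    have hΓ := hs.gammaBig_nonneg (k + 1)
    have hγ := hs.gammaSmall_nonneg (k + 1)
    have key : ∀ y, (D1 x y : ℝ) ≤ Γ (k + 1) + γ (k + 1) →
        (y ∈ badSet Γ γ σ k ↔ y ∈ badSet Γ γ τ k) := by
      intro y hy
      refine ih y σ τ fun z hz => h z ?_
      have := D1_triangle_real x y z
      rw [ModSteep.theta_succ]
      linarith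
    have hx := key x (by rw [D1_self]; push_cast; linarith)
    have hg := gentleOn_congr hγ hΓ key
    change (x ∈ badSet Γ γ σ k ∧ _) ↔ (x ∈ badSet Γ γ τ k ∧ _)
    rw [hx, hg]

lemma exists_far_of_mem_badSet_succ (hs : ModSteep d Γ γ a ε) {k : ℕ} {x : ZLat d}
    {ω : DConf d} (hx : x ∈ badSet Γ γ ω (k + 1)) :
    ∃ y ∈ ballFinset x (theta Γ γ (k + 1)), Γ (k + 1) / 2 ≤ (D1 x y : ℝ) ∧
      x ∈ badSet Γ γ ω k ∧ y ∈ badSet Γ γ ω k := by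
  obtain ⟨y, hy, h1, h2⟩ := exists_far_of_not_gentleOn (hs.gammaSmall_nonneg (k + 1))
    (hs.gammaBig_nonneg (k + 1)) hx.1 hx.2
  exact ⟨y, mem_ballFinset.2 (h2.trans (hs.add_le_theta_succ k)), h1, hx.1, hy⟩

end BadSet

section Disintegration

variable {d : ℕ} {Γ γ : ℕ → ℝ} {a ε : ℝ}

/-- The graded family of atoms of `ω`: singletons of good sites in grade `0`, gentle atoms in
higher grades. -/
def gradedAtoms (Γ γ : ℕ → ℝ) (ω : DConf d) : ℕ → Set (Set (ZLat d))
  | 0 => {s | ∃ x ∈ {x : ZLat d | ω x = false}, s = {x}}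
  | k + 1 => atomsAt Γ γ ω (k + 1)

lemma mem_badSet_diff_iff (hs : ModSteep d Γ γ a ε) (ω : DConf d) (k : ℕ) (x : ZLat d) :
    x ∈ badSet Γ γ ω k \ badSet Γ γ ω (k + 1) ↔ ∃ g ∈ atomsAt Γ γ ω (k + 1), x ∈ g := by
  constructor
  · rintro ⟨h1, h2⟩
    have hg : gentleOn Γ γ (badSet Γ γ ω k) (k + 1) x := by
      by_contra hc
      exact h2 ⟨h1, hc⟩
    exact ⟨_, ⟨x, hg, rfl⟩, hg.self_mem (hs.gammaBig_nonneg _)⟩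
  · rintro ⟨_, ⟨z, hz, rfl⟩, hx⟩
    exact ⟨hx.2, fun h => h.2 (hz.of_mem_atom (hs.gammaBig_lt k) hx)⟩

lemma Bres_gradedAtoms (hs : ModSteep d Γ γ a ε) (ω : DConf d) (k : ℕ) :
    Bres {x : ZLat d | ω x = false} (gradedAtoms Γ γ ω) k = badSet Γ γ ω k := by
  induction k with
  | zero =>
    ext x
    simp [Bres, badSet]
  | succ k ih =>
    have h : (⋃ g ∈ gradedAtoms Γ γ ω (k + 1), g) = badSet Γ γ ω k \ badSet Γ γ ω (k + 1) := by
      ext x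
      rw [mem_badSet_diff_iff hs]
      simp [gradedAtoms]
    rw [Bres, ih, h, Set.sdiff_sdiff_right_self]
    exact Set.inter_eq_right.2 (badSet_antitone ω (Nat.le_succ k))

lemma subset_gentleSet_of_mem_gradedAtoms (hs : ModSteep d Γ γ a ε) (ω : DConf d) {k : ℕ}
    {g : Set (ZLat d)} (hg : g ∈ gradedAtoms Γ γ ω k) : g ⊆ gentleSet Γ γ ω k := by
  intro x hx
  cases k with
  | zero =>
    obtain ⟨y, hy, rfl⟩ := hg
    rw [Set.mem_singleton_iff.1 hx]
    exact hy
  | succ k => exact (mem_badSet_diff_iff hs ω k x).2 ⟨g, hg, hx⟩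

lemma gentleSet_subset_badSet_compl (ω : DConf d) (k : ℕ) :
    gentleSet Γ γ ω k ⊆ (badSet Γ γ ω k)ᶜ := by
  intro x hx
  cases k with
  | zero =>
    have h : ω x = false := hx
    simp [badSet, h]
  | succ k => exact hx.2

lemma grade_eq_of_mem_gentleSet (ω : DConf d) {j k : ℕ} {x : ZLat d}
    (hj : x ∈ gentleSet Γ γ ω j) (hk : x ∈ gentleSet Γ γ ω k) : j = k := by
  have key : ∀ {j k : ℕ}, x ∈ gentleSet Γ γ ω j → x ∈ gentleSet Γ γ ω k → ¬ j < k := by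
    intro j k hj hk hlt
    obtain ⟨m, rfl⟩ : ∃ m, k = m + 1 := ⟨k - 1, by omega⟩
    exact gentleSet_subset_badSet_compl ω j hj
      (badSet_antitone ω (by omega : j ≤ m) hk.1)
  exact le_antisymm (not_lt.1 (key hk hj)) (not_lt.1 (key hj hk))

lemma gradedAtoms_nonempty (hs : ModSteep d Γ γ a ε) (ω : DConf d) {k : ℕ}
    {g : Set (ZLat d)} (hg : g ∈ gradedAtoms Γ γ ω k) : g.Nonempty := by
  cases k with
  | zero =>
    obtain ⟨y, hy, rfl⟩ := hg
    exact Set.singleton_nonempty y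
  | succ k =>
    obtain ⟨x, hx, rfl⟩ := hg
    exact ⟨x, hx.self_mem (hs.gammaBig_nonneg _)⟩

lemma gradedAtoms_eq_of_mem (hs : ModSteep d Γ γ a ε) (ω : DConf d) {k : ℕ}
    {g g' : Set (ZLat d)} (hg : g ∈ gradedAtoms Γ γ ω k) (hg' : g' ∈ gradedAtoms Γ γ ω k)
    {x : ZLat d} (hx : x ∈ g) (hx' : x ∈ g') : g = g' := by
  cases k with
  | zero =>
    obtain ⟨y, hy, rfl⟩ := hg
    obtain ⟨z, hz, rfl⟩ := hg'
    rw [← Set.mem_singleton_iff.1 hx, ← Set.mem_singleton_iff.1 hx']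
  | succ k =>
    obtain ⟨y, hy, rfl⟩ := hg
    obtain ⟨z, hz, rfl⟩ := hg'
    exact (hy.atom_eq (hs.gammaBig_lt k) hx).symm.trans (hz.atom_eq (hs.gammaBig_lt k) hx')

lemma gentleDisintegration_of_badSet (hs : ModSteep d Γ γ a ε) (ω : DConf d)
    (hcover : ∀ x : ZLat d, ∃ k, x ∉ badSet Γ γ ω k)
    (hhor : ∀ x : ZLat d,
      {k : ℕ | ∃ u ∈ cube x ⌊2 * theta Γ γ (k + 1)⌋₊, u ∈ badSet Γ γ ω k}.Finite) :
    Nonempty (GentleDisintegration d {x : ZLat d | ω x = false} Γ γ) := by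
  have hgrade : ∀ j j' g g' x, g ∈ gradedAtoms Γ γ ω j → g' ∈ gradedAtoms Γ γ ω j' →
      x ∈ g → x ∈ g' → j = j' := fun j j' g g' x hg hg' hx hx' =>
    grade_eq_of_mem_gentleSet ω (subset_gentleSet_of_mem_gradedAtoms hs ω hg hx)
      (subset_gentleSet_of_mem_gradedAtoms hs ω hg' hx')
  have hdiam : ∀ j, ∀ g ∈ gradedAtoms Γ γ ω (j + 1), ∀ u ∈ g, ∀ v ∈ g,
      (D1 u v : ℝ) ≤ Γ (j + 1) := by
    rintro j _ ⟨x, hx, rfl⟩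
    exact hx.2.1
  refine ⟨{ atoms := gradedAtoms Γ γ ω
            atomFinite := ?_
            atomNonempty := fun j g hg => gradedAtoms_nonempty hs ω hg
            uniqueGrade := ?_
            pairwiseDisjoint := ?_
            cover := ?_
            grade0 := rfl
            subsBad := ?_
            diamBound := ?_
            separation := ?_
            horizon := ?_ }⟩
  · rintro (_ | j) _ ⟨x, hx, rfl⟩
    · exact Set.finite_singleton x
    · exact (finite_ball1 _ _).subset Set.inter_subset_left
  · intro j j' g hg hg'
    obtain ⟨x, hx⟩ := gradedAtoms_nonempty hs ω hg
    exact hgrade j j' g g x hg hg' hx hx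
  · intro j j' g g' hg hg' hne
    rw [Set.disjoint_left]
    intro x hx hx'
    obtain rfl := hgrade j j' g g' x hg hg' hx hx'
    exact hne (gradedAtoms_eq_of_mem hs ω hg hg' hx hx')
  · intro x
    classical
    have hmin := fun m => Nat.find_min (m := m) (hcover x)
    have hspec := Nat.find_spec (hcover x)
    generalize Nat.find (hcover x) = n at hmin hspec
    cases n with
    | zero => exact ⟨0, {x}, ⟨x, by simpa [badSet] using hspec, rfl⟩, rfl⟩
    | succ n =>
      have h1 : x ∈ badSet Γ γ ω n := not_not.1 (hmin n (Nat.lt_succ_self n))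
      exact ⟨n + 1, (mem_badSet_diff_iff hs ω n x).1 ⟨h1, hspec⟩⟩
  · rintro j _ ⟨x, hx, rfl⟩
    rw [Bres_gradedAtoms hs]
    exact Set.inter_subset_right
  · intro j hj
    obtain ⟨m, rfl⟩ : ∃ m, j = m + 1 := ⟨j - 1, by omega⟩
    exact hdiam m
  · rintro j _ ⟨x, hx, rfl⟩
    rw [Bres_gradedAtoms hs]
    exact hx.2.2
  · intro x
    refine ((hhor x).image (· + 1)).subset ?_
    rintro j ⟨hj, g, hg, y, hy, hxy⟩
    obtain ⟨m, rfl⟩ : ∃ m, j = m + 1 := ⟨j - 1, by omega⟩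
    refine ⟨m, ?_, rfl⟩
    obtain ⟨u, hu⟩ := gradedAtoms_nonempty hs ω hg
    refine ⟨u, mem_cube.2 fun i => Nat.le_floor ?_,
      (subset_gentleSet_of_mem_gradedAtoms hs ω hg hu).1⟩
    have h1 : ((x i - y i).natAbs : ℝ) ≤ theta Γ γ (m + 1) := by
      refine le_trans ?_ hxy
      exact_mod_cast Finset.le_sup (f := fun i => (x i - y i).natAbs) (Finset.mem_univ i)
    have h2 := natAbs_le_of_mem_env (hdiam m g hg) hy hu i
    have h3 : ((x i - u i).natAbs : ℝ) ≤ (x i - y i).natAbs + (y i - u i).natAbs := by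
      have : (x i - u i).natAbs ≤ (x i - y i).natAbs + (y i - u i).natAbs := by omega
      exact_mod_cast this
    have := hs.add_le_theta_succ m
    have := hs.gammaSmall_nonneg (m + 1)
    linarith

end Disintegration

section Probability

variable {d : ℕ} {Q : Measure (DConf d)} {b'' B'' : ℝ}

lemma measurableSet_of_local {E : Set (DConf d)} (S : Finset (ZLat d))
    (hE : ∀ σ τ : DConf d, (∀ x ∈ S, σ x = τ x) → (σ ∈ E ↔ τ ∈ E)) : MeasurableSet E := by
  have hr : Measurable (fun (ω : DConf d) (x : S) => ω x) := by fun_prop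
  have h : E = (fun (ω : DConf d) (x : S) => ω x) ⁻¹'
      ((fun (ω : DConf d) (x : S) => ω x) '' E) := by
    refine Set.Subset.antisymm (Set.subset_preimage_image _ _) ?_
    rintro σ ⟨τ, hτ, h⟩
    exact (hE τ σ fun x hx => congrFun h ⟨x, hx⟩).1 hτ
  rw [h]
  exact hr (Set.toFinite _).measurableSet

lemma localOn_indicator {E : Set (DConf d)} {S : Finset (ZLat d)}
    (hE : ∀ σ τ : DConf d, (∀ x ∈ S, σ x = τ x) → (σ ∈ E ↔ τ ∈ E)) :
    LocalOn (E.indicator fun _ => (1 : ℝ)) S := by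
  classical
  intro σ τ h
  simp only [Set.indicator_apply, hE σ τ h]

lemma supNorm_nonneg {α : Type*} (f : α → ℝ) : 0 ≤ supNorm f :=
  Real.iSup_nonneg fun _ => abs_nonneg _

lemma supNorm_indicator_le {α : Type*} (E : Set α) :
    supNorm (E.indicator fun _ => (1 : ℝ)) ≤ 1 := by
  classical
  refine Real.iSup_le (fun x => ?_) zero_le_one
  rw [Set.indicator_apply]
  split_ifs <;> simp

/-- The decay condition for pairs of local events. -/
lemma Smin.abs_measureReal_inter_sub_le (hQ : Smin Q b'' B'') (hb : 0 ≤ b'') (hB : 0 ≤ B'')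
    {E F : Set (DConf d)} {S T : Finset (ZLat d)} {N r : ℝ}
    (hE : ∀ σ τ : DConf d, (∀ x ∈ S, σ x = τ x) → (σ ∈ E ↔ τ ∈ E))
    (hF : ∀ σ τ : DConf d, (∀ x ∈ T, σ x = τ x) → (σ ∈ F ↔ τ ∈ F))
    (hS : S.Nonempty) (hT : T.Nonempty) (hN : (S.card : ℝ) ≤ N)
    (hr : ∀ x ∈ S, ∀ y ∈ T, r ≤ (D1 x y : ℝ)) (hle : N * Real.exp (-b'' * r) ≤ 1) :
    |Q.real (E ∩ F) - Q.real E * Q.real F| ≤ B'' * N * Real.exp (-b'' * r) := by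
  have hEm := measurableSet_of_local S hE
  have hFm := measurableSet_of_local T hF
  have hdist : r ≤ fDist1 S T := by
    obtain ⟨x, hx⟩ := hS
    obtain ⟨y, hy⟩ := hT
    refine le_csInf ⟨_, (x, y), ⟨hx, hy⟩, rfl⟩ ?_
    rintro _ ⟨p, ⟨h1, h2⟩, rfl⟩
    exact hr _ h1 _ h2
  have hm : (min S.card T.card : ℝ) ≤ N := (min_le_left _ _).trans hN
  have hm0 : (0 : ℝ) ≤ (min S.card T.card : ℝ) := by positivity
  have hexp : Real.exp (-b'' * fDist1 S T) ≤ Real.exp (-b'' * r) := by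
    apply Real.exp_le_exp.2
    nlinarith
  have hprod : (min S.card T.card : ℝ) * Real.exp (-b'' * fDist1 S T)
      ≤ N * Real.exp (-b'' * r) := by
    gcongr
    exact hm0.trans hm
  have h := hQ _ _ S T (localOn_indicator hE) (localOn_indicator hF) (hprod.trans hle)
  have hmul : (fun ω => E.indicator (fun _ => (1 : ℝ)) ω * F.indicator (fun _ => (1 : ℝ)) ω)
      = (E ∩ F).indicator fun _ => (1 : ℝ) := by
    funext ω
    rw [← Set.inter_indicator_mul]
    simp
  rw [hmul, integral_indicator_const _ (hEm.inter hFm), integral_indicator_const _ hEm,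
    integral_indicator_const _ hFm] at h
  simp only [smul_eq_mul, mul_one] at h
  refine h.trans ?_
  have hsE := supNorm_indicator_le E
  have hsF := supNorm_indicator_le F
  have hsE0 := supNorm_nonneg (E.indicator fun _ => (1 : ℝ))
  have hsF0 := supNorm_nonneg (F.indicator fun _ => (1 : ℝ))
  calc B'' * supNorm (E.indicator fun _ => (1 : ℝ)) * supNorm (F.indicator fun _ => (1 : ℝ))
          * (min S.card T.card : ℝ) * Real.exp (-b'' * fDist1 S T)
      = (B'' * supNorm (E.indicator fun _ => (1 : ℝ))
          * supNorm (F.indicator fun _ => (1 : ℝ)))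
          * ((min S.card T.card : ℝ) * Real.exp (-b'' * fDist1 S T)) := by ring
    _ ≤ (B'' * 1 * 1) * (N * Real.exp (-b'' * r)) := by gcongr
    _ = B'' * N * Real.exp (-b'' * r) := by ring

/-- Applied to a single site, the decay condition bounds the variance of `ω_x` by `B''`. -/
lemma Smin.measureReal_site_le (hQ : Smin Q b'' B'') (hb : 0 ≤ b'') (hB : 0 ≤ B'')
    {x : ZLat d} (hx : Q.real {ω | ω x = true} ≤ 1 / 2) :
    Q.real {ω | ω x = true} ≤ 2 * B'' := by
  have hloc : ∀ σ τ : DConf d, (∀ y ∈ ({x} : Finset (ZLat d)), σ y = τ y) →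
      (σ ∈ {ω : DConf d | ω x = true} ↔ τ ∈ {ω : DConf d | ω x = true}) := by
    intro σ τ h
    simp [h x (by simp)]
  have h := hQ.abs_measureReal_inter_sub_le hb hB (N := 1) (r := 0) hloc hloc
    (Finset.singleton_nonempty x) (Finset.singleton_nonempty x) (by simp)
    (fun _ _ _ _ => by positivity) (by simp)
  rw [Set.inter_self] at h
  have h0 : 0 ≤ Q.real {ω | ω x = true} := measureReal_nonneg
  have := (le_abs_self _).trans h
  simp only [mul_one, mul_zero, Real.exp_zero] at this
  nlinarith

variable {Γ γ : ℕ → ℝ} {a ε : ℝ} [IsProbabilityMeasure Q]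

/-- The recursive bound on the probability of being `k`-bad. -/
lemma measureReal_mem_badSet_le (hs : ModSteep d Γ γ a ε) (hb : 0 < b'') (hB : 0 < B'')
    (hQ : Smin Q b'' B'')
    (hp : ∀ x : ZLat d, Q.real {ω | ω x = true} ≤ Real.exp (-a / (1 - ε)))
    (hgag : ∀ k : ℕ,
      2 * 9 ^ d * B'' * theta Γ γ (k + 1) ^ (2 * d) *
          Real.exp (-b'' * Γ (k + 1) / 20) ≤
        Real.exp (-(a / (1 - ε)) * (1 + ε) ^ (k + 1))) (k : ℕ) :
    ∀ x : ZLat d, Q.real {ω | x ∈ badSet Γ γ ω k} ≤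
      Real.exp (-(a / (1 - ε)) * (1 + ε) ^ k) := by
  have hε := hs.epsMem
  have hε1 : 0 < 1 - ε := by linarith [hε.2]
  have ha := hs.apos
  induction k with
  | zero =>
    intro x
    have := hp x
    simpa [badSet, neg_div] using this
  | succ k ih =>
    intro x
    have hθ := hs.one_le_theta_succ k
    have hΓ := hs.two_le_gammaBig_succ k
    set θ := theta Γ γ (k + 1) with hθdef
    set P := Real.exp (-(a / (1 - ε)) * (1 + ε) ^ k) with hP
    set P' := Real.exp (-(a / (1 - ε)) * (1 + ε) ^ (k + 1)) with hP'
    set e := Real.exp (-b'' * Γ (k + 1) / 20) with he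
    set N : ℝ := 3 ^ d * θ ^ d with hN
    have hN1 : 1 ≤ N := by
      have h1 : (1 : ℝ) ≤ 3 ^ d := one_le_pow₀ (by norm_num)
      have h2 : (1 : ℝ) ≤ θ ^ d := one_le_pow₀ hθ
      nlinarith
    have hNN : (9 : ℝ) ^ d * θ ^ (2 * d) = N * N := by
      rw [hN, pow_mul', show (9 : ℝ) = 3 * 3 by norm_num, mul_pow]
      ring
    have hgagk : 2 * B'' * (N * N) * e ≤ P' := by
      have := hgag k
      calc 2 * B'' * (N * N) * e = 2 * 9 ^ d * B'' * θ ^ (2 * d) * e := by rw [← hNN]; ring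
        _ ≤ P' := this
    set r := 3 * Γ (k + 1) / 10 with hr
    have hexp : Real.exp (-b'' * r) ≤ e := by
      apply Real.exp_le_exp.2
      rw [hr]
      nlinarith
    have he0 : 0 < e := Real.exp_pos _
    by_cases hcase : N * Real.exp (-b'' * r) ≤ 1
    · have hpair : ∀ y ∈ (ballFinset x θ).filter (fun y => Γ (k + 1) / 2 ≤ (D1 x y : ℝ)),
          Q.real ({ω | x ∈ badSet Γ γ ω k} ∩ {ω | y ∈ badSet Γ γ ω k}) ≤
            P * P + B'' * N * e := by
        intro y hy
        have hxy := (Finset.mem_filter.1 hy).2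
        have hloc : ∀ z : ZLat d, ∀ σ τ : DConf d,
            (∀ w ∈ ballFinset z (theta Γ γ k), σ w = τ w) →
            (σ ∈ {ω | z ∈ badSet Γ γ ω k} ↔ τ ∈ {ω | z ∈ badSet Γ γ ω k}) :=
          fun z σ τ h => mem_badSet_congr hs k z σ τ fun w hw => h w (mem_ballFinset.2 hw)
        have hne : ∀ z : ZLat d, (ballFinset z (theta Γ γ k)).Nonempty := fun z =>
          ⟨z, mem_ballFinset.2 (by rw [D1_self]; exact_mod_cast hs.theta_nonneg k)⟩
        have h := hQ.abs_measureReal_inter_sub_le hb.le hB.le (N := N) (r := r)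
          (hloc x) (hloc y) (hne x) (hne y)
          (card_ballFinset_le x (hs.theta_nonneg k) (hs.theta_le_succ k) hθ) ?_ hcase
        · have h1 := (le_abs_self _).trans h
          have h2 : Q.real {ω | x ∈ badSet Γ γ ω k} * Q.real {ω | y ∈ badSet Γ γ ω k} ≤
              P * P := mul_le_mul (ih x) (ih y) measureReal_nonneg (Real.exp_pos _).le
          have h3 : B'' * N * Real.exp (-b'' * r) ≤ B'' * N * e := by gcongr
          linarith
        · intro u hu v hv
          have hu' := mem_ballFinset.1 hu
          have hv' := mem_ballFinset.1 hv
          have h1 := D1_triangle_real x u y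
          have h2 := D1_triangle_real u v y
          rw [D1_comm v y] at h2
          have := hs.lam k
          rw [hr]
          linarith
      have hsub : {ω | x ∈ badSet Γ γ ω (k + 1)} ⊆
          ⋃ y ∈ (ballFinset x θ).filter (fun y => Γ (k + 1) / 2 ≤ (D1 x y : ℝ)),
            ({ω | x ∈ badSet Γ γ ω k} ∩ {ω | y ∈ badSet Γ γ ω k}) := by
        intro ω hω
        obtain ⟨y, hy, h1, h2, h3⟩ := exists_far_of_mem_badSet_succ hs hω
        exact Set.mem_biUnion (Finset.mem_filter.2 ⟨hy, h1⟩ :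
          y ∈ (ballFinset x θ).filter (fun y => Γ (k + 1) / 2 ≤ (D1 x y : ℝ))) ⟨h2, h3⟩
      have hgrow : 2 * N * (P * P) ≤ P' := by
        have h1 := hs.growth k
        have h2 : Real.exp (a * (1 + ε) ^ k) * (P * P) = P' := by
          rw [hP, hP', ← Real.exp_add, ← Real.exp_add]
          congr 1
          field_simp
          ring
        rw [← h2]
        gcongr
        calc 2 * N = 2 * 3 ^ d * θ ^ d := by rw [hN]; ring
          _ ≤ _ := h1
      calc Q.real {ω | x ∈ badSet Γ γ ω (k + 1)}
          ≤ Q.real (⋃ y ∈ (ballFinset x θ).filter (fun y => Γ (k + 1) / 2 ≤ (D1 x y : ℝ)),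
            ({ω | x ∈ badSet Γ γ ω k} ∩ {ω | y ∈ badSet Γ γ ω k})) :=
          measureReal_mono hsub (measure_ne_top _ _)
        _ ≤ ∑ y ∈ (ballFinset x θ).filter (fun y => Γ (k + 1) / 2 ≤ (D1 x y : ℝ)),
            Q.real ({ω | x ∈ badSet Γ γ ω k} ∩ {ω | y ∈ badSet Γ γ ω k}) :=
          measureReal_biUnion_finset_le _ _
        _ ≤ ((ballFinset x θ).filter (fun y => Γ (k + 1) / 2 ≤ (D1 x y : ℝ))).card •
            (P * P + B'' * N * e) := Finset.sum_le_card_nsmul _ _ _ hpair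
        _ ≤ N * (P * P + B'' * N * e) := by
          rw [nsmul_eq_mul]
          gcongr
          refine le_trans ?_ (card_ballFinset_le x (zero_le_one.trans hθ) le_rfl hθ)
          exact_mod_cast Finset.card_filter_le _ _
        _ ≤ P' := by nlinarith
    · -- Here `B''` is so small that the bound already holds for single bad sites.
      have hNe : 1 ≤ (N * N) * e := by
        have h1 : N * Real.exp (-b'' * r) ≤ N * e := by gcongr
        have h2 : N * e ≤ N * N * e := by
          have : N ≤ N * N := by nlinarith
          gcongr
        linarith
      have hhalf : Q.real {ω | ω x = true} ≤ 1 / 2 := by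
        refine (hp x).trans ?_
        have h1 := hs.growth 0
        have h2 : (1 : ℝ) ≤ 3 ^ d * theta Γ γ (0 + 1) ^ d := by
          have h1 : (1 : ℝ) ≤ 3 ^ d := one_le_pow₀ (by norm_num)
          have h2 : (1 : ℝ) ≤ theta Γ γ (0 + 1) ^ d := one_le_pow₀ (hs.one_le_theta_succ 0)
          nlinarith
        have h3 : 2 ≤ Real.exp a := by
          rw [pow_zero, mul_one] at h1
          linarith
        have h4 : Real.exp (-a / (1 - ε)) ≤ Real.exp (-a) := by
          apply Real.exp_le_exp.2
          rw [neg_div, neg_le_neg_iff, le_div_iff₀ hε1]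
          nlinarith [hε.1]
        rw [Real.exp_neg] at h4
        refine h4.trans ?_
        rw [one_div]
        exact inv_anti₀ (by norm_num) h3
      calc Q.real {ω | x ∈ badSet Γ γ ω (k + 1)} ≤ Q.real {ω | ω x = true} :=
            measureReal_mono fun ω hω => badSet_antitone ω (Nat.zero_le (k + 1)) hω
        _ ≤ 2 * B'' := hQ.measureReal_site_le hb.le hB.le hhalf
        _ ≤ 2 * B'' * ((N * N) * e) := le_mul_of_one_le_right (by positivity) hNe
        _ = 2 * B'' * (N * N) * e := by ring
        _ ≤ P' := hgagk

lemma summable_theta_pow_mul_exp (hs : ModSteep d Γ γ a ε) :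
    Summable fun k : ℕ =>
      (5 : ℝ) ^ d * theta Γ γ (k + 1) ^ d * Real.exp (-(a / (1 - ε)) * (1 + ε) ^ k) := by
  have hε := hs.epsMem
  have ha := hs.apos
  have h := (hs.tail d (Nat.cast_nonneg d) 2 one_lt_two).comp_injective (Nat.succ_injective)
  refine Summable.of_nonneg_of_le (fun k => ?_) (fun k => ?_) (h.mul_left ((5 : ℝ) ^ d))
  · have := hs.theta_nonneg (k + 1)
    positivity
  · have hθ := hs.theta_nonneg (k + 1)
    simp only [Function.comp_apply, Nat.succ_eq_add_one, Real.rpow_natCast, mul_assoc]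
    gcongr
    have h1 : a ≤ a / (1 - ε) := by
      rw [le_div_iff₀ (by linarith [hε.2])]
      nlinarith [hε.1]
    have h2 : (0 : ℝ) < (1 + ε) ^ k := pow_pos (by linarith [hε.1]) k
    rw [pow_succ]
    nlinarith [mul_le_mul_of_nonneg_right h1 h2.le, mul_pos ha h2, hε.2]

end Probability

/-- Almost-sure existence of a gentle disintegration. Under the
moderately steep scales hypotheses, the decay condition (smin), the dilution bound
`p ≤ exp(−a/(1−ε))` and condition (gag), there is a set `Ω̄` of full `Q`-measure such
that for every `ω ∈ Ω̄` there exists a gentle disintegration of `ℤ^d` with respect to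
`G_0(ω) = {x : ω_x = 0}`, `Γ`, `γ`. -/
theorem stmt3 {d : ℕ} (Γ γ : ℕ → ℝ) (a ε : ℝ) (hs : ModSteep d Γ γ a ε)
    (Q : Measure (DConf d)) [IsProbabilityMeasure Q]
    (b'' B'' : ℝ) (hb : 0 < b'') (hB : 0 < B'') (hQ : Smin Q b'' B'')
    (hp : ∀ x : ZLat d,
      Q {ω | ω x = true} ≤ ENNReal.ofReal (Real.exp (-a / (1 - ε))))
    (hgag : ∀ k : ℕ,
      2 * 9 ^ d * B'' * theta Γ γ (k + 1) ^ (2 * d) *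
          Real.exp (-b'' * Γ (k + 1) / 20) ≤
        Real.exp (-(a / (1 - ε)) * (1 + ε) ^ (k + 1))) :
    ∃ Ωbar : Set (DConf d), MeasurableSet Ωbar ∧ Q Ωbar = 1 ∧
      ∀ ω ∈ Ωbar,
        Nonempty (GentleDisintegration d {x : ZLat d | ω x = false} Γ γ) := by
  have hp' : ∀ x : ZLat d, Q.real {ω | ω x = true} ≤ Real.exp (-a / (1 - ε)) := fun x =>
    ENNReal.toReal_le_of_le_ofReal (Real.exp_pos _).le (hp x)
  have hbad := measureReal_mem_badSet_le hs hb hB hQ hp' hgag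
  have hsum := summable_theta_pow_mul_exp hs
  have hhor : ∀ x : ZLat d, ∀ᵐ ω ∂Q,
      {k : ℕ | ∃ u ∈ cube x ⌊2 * theta Γ γ (k + 1)⌋₊, u ∈ badSet Γ γ ω k}.Finite := by
    intro x
    let E : ℕ → Set (DConf d) := fun k =>
      ⋃ u ∈ cube x ⌊2 * theta Γ γ (k + 1)⌋₊, {ω | u ∈ badSet Γ γ ω k}
    have hE : ∀ k, Q.real (E k) ≤
        (5 : ℝ) ^ d * theta Γ γ (k + 1) ^ d * Real.exp (-(a / (1 - ε)) * (1 + ε) ^ k) := by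
      intro k
      have hθ := hs.one_le_theta_succ k
      calc Q.real (E k)
          ≤ ∑ u ∈ cube x ⌊2 * theta Γ γ (k + 1)⌋₊, Q.real {ω | u ∈ badSet Γ γ ω k} :=
            measureReal_biUnion_finset_le _ _
        _ ≤ (cube x ⌊2 * theta Γ γ (k + 1)⌋₊).card •
              Real.exp (-(a / (1 - ε)) * (1 + ε) ^ k) :=
            Finset.sum_le_card_nsmul _ _ _ fun u _ => hbad k u
        _ ≤ _ := by
            rw [nsmul_eq_mul, card_cube, ← mul_pow]
            push_cast
            gcongr
            have := Nat.floor_le (by linarith : 0 ≤ 2 * theta Γ γ (k + 1))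
            linarith
    have hfin : ∑' k, Q (E k) ≠ ⊤ := by
      refine ne_top_of_le_ne_top hsum.tsum_ofReal_ne_top (ENNReal.tsum_le_tsum fun k => ?_)
      rw [← ofReal_measureReal (measure_ne_top _ _)]
      exact ENNReal.ofReal_le_ofReal (hE k)
    filter_upwards [ae_finite_setOfPred_mem hfin] with ω hω
    simpa [E] using hω
  have hae : ∀ᵐ ω ∂Q,
      Nonempty (GentleDisintegration d {x : ZLat d | ω x = false} Γ γ) := by
    filter_upwards [ae_all_iff.2 hhor] with ω hω
    refine gentleDisintegration_of_badSet hs ω (fun x => ?_) hω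
    obtain ⟨k, hk⟩ := (hω x).exists_notMem
    refine ⟨k, fun hx => hk ⟨x, mem_cube.2 fun i => by simp, hx⟩⟩
  obtain ⟨t, ht, htm, htQ⟩ := exists_measurable_superset_of_null (ae_iff.1 hae)
  refine ⟨tᶜ, htm.compl, (prob_compl_eq_one_iff htm).2 htQ, fun ω hω => ?_⟩
  by_contra hc
  exact hω (ht hc)

end

end Paper
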